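/- Let I be a *-ideal of ℂ[X₁,…,Xₙ] and let P ∈ ℂ[X₁,…,Xₙ]. Then P ∈ I_ℂ(Z(I)) (equivalently, P belongs to the *-real radical of I) if and only if there exist finitely many polynomials Q₁,…,Q_s ∈ ℂ[X₁,…,Xₙ] and an integer m ≥ 0 such that (P*P)^(2m) + Q₁*Q₁ + ⋯ + Q_s*Q_s ∈ I. -/

import Mathlib

open MeasureTheory
open scoped ComplexOrder

noncomputable def evalC {n : ℕ} (P : MvPolynomial (Fin n) ℂ) (x : Fin n → ℝ) : ℂ :=
  MvPolynomial.aeval (fun i => (x i : ℂ)) P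

noncomputable def starC {n : ℕ} (P : MvPolynomial (Fin n) ℂ) : MvPolynomial (Fin n) ℂ :=
  MvPolynomial.map (starRingEnd ℂ) P

def IsPosDefC {n : ℕ} (Λ : MvPolynomial (Fin n) ℂ →ₗ[ℂ] ℂ) : Prop :=
  ∀ P : MvPolynomial (Fin n) ℂ, 0 ≤ Λ (starC P * P)

def IsMomentC {n : ℕ} (Λ : MvPolynomial (Fin n) ℂ →ₗ[ℂ] ℂ) : Prop :=
  ∃ μ : Measure (Fin n → ℝ),
    (∀ Q : MvPolynomial (Fin n) ℂ, Integrable (fun x => evalC Q x) μ) ∧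
    (∀ Q : MvPolynomial (Fin n) ℂ, Λ Q = ∫ x, evalC Q x ∂μ)

noncomputable def vanishingIdealC {n : ℕ} (Z : Set (Fin n → ℝ)) :
    Ideal (MvPolynomial (Fin n) ℂ) where
  carrier := {P | ∀ x ∈ Z, evalC P x = 0}
  add_mem' := by
    intro a b ha hb x hx
    simp only [Set.mem_setOf_eq, evalC, map_add] at *
    rw [ha x hx, hb x hx, add_zero]
  zero_mem' := by
    intro x hx
    simp [evalC]
  smul_mem' := by
    intro c a ha x hx
    simp only [Set.mem_setOf_eq, evalC, smul_eq_mul, map_mul] at *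
    rw [ha x hx, mul_zero]

def zeroSetC {n : ℕ} (I : Ideal (MvPolynomial (Fin n) ℂ)) : Set (Fin n → ℝ) :=
  {x | ∀ P ∈ I, evalC P x = 0}

def zSetC {n : ℕ} (P : MvPolynomial (Fin n) ℂ) : Set (Fin n → ℝ) :=
  {x | evalC P x = 0}

def VanishesOnC {n : ℕ} (Λ : MvPolynomial (Fin n) ℂ →ₗ[ℂ] ℂ)
    (I : Ideal (MvPolynomial (Fin n) ℂ)) : Prop :=
  ∀ P ∈ I, Λ P = 0

def nSetC {n : ℕ} (Λ : MvPolynomial (Fin n) ℂ →ₗ[ℂ] ℂ) : Set (MvPolynomial (Fin n) ℂ) :=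
  {P | Λ (starC P * P) = 0}

def IsTypeAC {n : ℕ} (P : MvPolynomial (Fin n) ℂ) : Prop :=
  ∀ Λ : MvPolynomial (Fin n) ℂ →ₗ[ℂ] ℂ,
    IsPosDefC Λ → VanishesOnC Λ (Ideal.span {P}) → IsMomentC Λ

section RealAlgebra

open Polynomial

/-- The intermediate value property for polynomials over an ordered field. -/
def PolynomialIVT (K : Type*) [Field K] [LinearOrder K] : Prop :=
  ∀ (p : K[X]) (a b : K), a < b → p.eval a < 0 → 0 < p.eval b →
    ∃ c, a < c ∧ c < b ∧ p.eval c = 0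

namespace PolynomialIVT

variable {K : Type*} [Field K] [LinearOrder K] [IsStrictOrderedRing K]

theorem exists_root_of_mul_neg (hK : PolynomialIVT K) (p : K[X]) {a b : K} (hab : a < b)
    (h : p.eval a * p.eval b < 0) : ∃ c, a < c ∧ c < b ∧ p.eval c = 0 := by
  rcases mul_neg_iff.1 h with ⟨ha, hb⟩ | ⟨ha, hb⟩
  · simpa using hK (-p) a b hab (by simpa using ha) (by simpa using hb)
  · exact hK p a b hab ha hb

theorem eval_mul_pos (hK : PolynomialIVT K) (p : K[X]) {a b x y : K}
    (h : ∀ c, a < c → c < b → p.eval c ≠ 0) (hx : a < x ∧ x < b) (hy : a < y ∧ y < b) :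
    0 < p.eval x * p.eval y := by
  wlog hxy : x ≤ y generalizing x y
  · rw [mul_comm]; exact this hy hx (le_of_not_ge hxy)
  rcases hxy.eq_or_lt with rfl | hlt
  · exact mul_self_pos.2 (h x hx.1 hx.2)
  by_contra hneg
  have hne := mul_ne_zero (h x hx.1 hx.2) (h y hy.1 hy.2)
  obtain ⟨c, h1, h2, h3⟩ := hK.exists_root_of_mul_neg p hlt (lt_of_le_of_ne (not_lt.1 hneg) hne)
  exact h c (hx.1.trans h1) (h2.trans hy.2) h3

theorem rolle_of_consecutive (hK : PolynomialIVT K) {p : K[X]} (hp : p ≠ 0) {a b : K}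
    (hab : a < b) (ha : p.eval a = 0) (hb : p.eval b = 0)
    (h : ∀ c, a < c → c < b → p.eval c ≠ 0) :
    ∃ c, a < c ∧ c < b ∧ p.derivative.eval c = 0 := by
  obtain ⟨q₁, hq₁, hqa⟩ := exists_eq_pow_rootMultiplicity_mul_and_not_dvd p hp a
  have hq₁0 : q₁ ≠ 0 := by rintro rfl; simp at hqa
  obtain ⟨q, hq, hqb⟩ := exists_eq_pow_rootMultiplicity_mul_and_not_dvd q₁ hq₁0 b
  have hm : p.rootMultiplicity a ≠ 0 := by
    rw [← pos_iff_ne_zero, rootMultiplicity_pos hp]; exact ha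
  have hl : q₁.rootMultiplicity b ≠ 0 := by
    rw [← pos_iff_ne_zero, rootMultiplicity_pos hq₁0]
    rw [hq₁, eval_mul] at hb
    refine (mul_eq_zero.1 hb).resolve_left ?_
    simpa using fun hba => absurd (sub_eq_zero.1 hba) hab.ne'
  obtain ⟨k, hk⟩ := Nat.exists_eq_succ_of_ne_zero hm
  obtain ⟨j, hj⟩ := Nat.exists_eq_succ_of_ne_zero hl
  rw [hk] at hq₁
  rw [hj] at hq
  clear hk hj hm hl
  rw [dvd_iff_isRoot, IsRoot.def] at hqa hqb
  have hqa' : q.eval a ≠ 0 := by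
    intro h0; apply hqa; rw [hq]; simp [h0]
  have hpq : p = (X - C a) ^ (k + 1) * ((X - C b) ^ (j + 1) * q) := by rw [← hq]; exact hq₁
  have hnz : ∀ c, a < c → c < b → q.eval c ≠ 0 := by
    intro c h1 h2 h0
    apply h c h1 h2
    rw [hpq]; simp [h0]
  set r : K[X] := C ((k : K) + 1) * (X - C b) * q + C ((j : K) + 1) * (X - C a) * q
    + (X - C a) * (X - C b) * derivative q with hr
  have hder : derivative p = (X - C a) ^ k * (X - C b) ^ j * r := by
    rw [hpq, hr]
    simp only [derivative_mul, derivative_X_sub_C_pow, Nat.add_sub_cancel, map_add, map_natCast,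
      map_one, Nat.cast_add, Nat.cast_one]
    ring
  have hqab : 0 < q.eval a * q.eval b := by
    by_contra hneg
    obtain ⟨c, h1, h2, h3⟩ := hK.exists_root_of_mul_neg q hab
      (lt_of_le_of_ne (not_lt.1 hneg) (mul_ne_zero hqa' hqb))
    exact hnz c h1 h2 h3
  have hrab : r.eval a * r.eval b < 0 := by
    have : r.eval a * r.eval b
        = -(((k : K) + 1) * ((j : K) + 1) * (b - a) ^ 2 * (q.eval a * q.eval b)) := by
      simp [hr]; ring
    rw [this, neg_lt_zero]
    have := sub_pos.2 hab
    positivity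
  obtain ⟨c, h1, h2, h3⟩ := hK.exists_root_of_mul_neg r hab hrab
  exact ⟨c, h1, h2, by rw [hder]; simp [h3]⟩

theorem rolle (hK : PolynomialIVT K) (p : K[X]) {a b : K} (hab : a < b)
    (ha : p.eval a = 0) (hb : p.eval b = 0) :
    ∃ c, a < c ∧ c < b ∧ p.derivative.eval c = 0 := by
  by_cases hp : p = 0
  · obtain ⟨c, h1, h2⟩ := exists_between hab
    exact ⟨c, h1, h2, by simp [hp]⟩
  obtain ⟨m, hm, hmin⟩ := Finset.exists_min_image (p.roots.toFinset.filter (a < ·)) id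
    ⟨b, by simp [hp, hab, hb]⟩
  simp only [Finset.mem_filter, Multiset.mem_toFinset, mem_roots hp, IsRoot.def, id] at hm hmin
  obtain ⟨c, h1, h2, h3⟩ := hK.rolle_of_consecutive hp hm.2 ha hm.1
    fun c h1 h2 h0 => (hmin c ⟨h0, h1⟩).not_gt h2
  exact ⟨c, h1, h2.trans_le (hmin b ⟨hb, hab⟩), h3⟩

theorem mean_value (hK : PolynomialIVT K) (p : K[X]) {a b : K} (hab : a < b) :
    ∃ c, a < c ∧ c < b ∧ p.eval b - p.eval a = p.derivative.eval c * (b - a) := by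
  obtain ⟨c, h1, h2, h3⟩ := hK.rolle
    (C (b - a) * (p - C (p.eval a)) - C (p.eval b - p.eval a) * (X - C a)) hab (by simp)
    (by simp; ring)
  refine ⟨c, h1, h2, ?_⟩
  simp only [derivative_mul, derivative_sub, derivative_C, derivative_X, eval_sub, eval_mul, eval_C,
    zero_mul, zero_add, sub_zero, mul_one] at h3
  linear_combination -h3

theorem eq_of_isRoot (hK : PolynomialIVT K) (p : K[X]) {a b x y : K}
    (h : ∀ c, a < c → c < b → p.derivative.eval c ≠ 0) (hx : a < x ∧ x < b) (hy : a < y ∧ y < b)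
    (hpx : p.eval x = 0) (hpy : p.eval y = 0) : x = y := by
  wlog hxy : x ≤ y generalizing x y
  · exact (this hy hx hpy hpx (le_of_not_ge hxy)).symm
  rcases hxy.eq_or_lt with rfl | hlt
  · rfl
  obtain ⟨c, h1, h2, h3⟩ := hK.rolle p hlt hpx hpy
  exact absurd h3 (h c (hx.1.trans h1) (h2.trans hy.2))

theorem eval_mul_eval_neg (hK : PolynomialIVT K) (p : K[X]) {a b x : K}
    (h : ∀ c, a < c → c < b → p.derivative.eval c ≠ 0) (hx : a < x ∧ x < b)
    (hpx : p.eval x = 0) : p.eval a * p.eval b < 0 := by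
  obtain ⟨c, h1, h2, h3⟩ := hK.mean_value p hx.1
  obtain ⟨d, h4, h5, h6⟩ := hK.mean_value p hx.2
  have hcd := hK.eval_mul_pos p.derivative h ⟨h1, h2.trans hx.2⟩ ⟨hx.1.trans h4, h5⟩
  have : p.eval a * p.eval b
      = -((p.derivative.eval c * p.derivative.eval d) * ((x - a) * (b - x))) := by
    rw [hpx] at h3 h6
    linear_combination (-p.eval b) * h3 - p.derivative.eval c * (x - a) * h6
  rw [this, neg_lt_zero]
  exact mul_pos hcd (mul_pos (sub_pos.2 hx.1) (sub_pos.2 hx.2))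

end PolynomialIVT

theorem PolynomialIVT.real : PolynomialIVT ℝ := by
  intro p a b hab ha hb
  obtain ⟨c, ⟨h1, h2⟩, h3⟩ := intermediate_value_Ioo hab.le p.continuous.continuousOn ⟨ha, hb⟩
  exact ⟨c, h1, h2, h3⟩

theorem PolynomialIVT.germ {α F : Type*} [Field F] [LinearOrder F] (hF : PolynomialIVT F)
    (U : Ultrafilter α) : PolynomialIVT (Filter.Germ (U : Filter α) F) := by
  intro p a b
  obtain ⟨P, rfl⟩ := Polynomial.map_surjective (Filter.Germ.coeRingHom (U : Filter α))
    (fun g => g.inductionOn fun f => ⟨f, rfl⟩) p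
  have key : ∀ f : α → F, eval (f : Filter.Germ (U : Filter α) F)
      (P.map (Filter.Germ.coeRingHom (U : Filter α))) =
      ((fun i => eval (f i) (P.map (Pi.evalRingHom _ i)) : α → F) :
        Filter.Germ (U : Filter α) F) := by
    intro f
    have h1 := Polynomial.eval₂_at_apply (p := P) (Filter.Germ.coeRingHom (U : Filter α)) f
    rw [← eval_map] at h1
    refine h1.trans ?_
    change ((eval f P : α → F) : Filter.Germ (U : Filter α) F) = _
    congr 1
    funext i
    have h2 := Polynomial.eval₂_at_apply (p := P) (Pi.evalRingHom (fun _ => F) i) f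
    rw [← eval_map] at h2
    exact h2.symm
  induction a using Filter.Germ.inductionOn with | _ a
  induction b using Filter.Germ.inductionOn with | _ b
  intro hab ha hb
  rw [key] at ha hb
  rw [Filter.Germ.coe_lt] at hab
  change _ < ((fun _ => 0 : α → F) : Filter.Germ (U : Filter α) F) at ha
  change ((fun _ => 0 : α → F) : Filter.Germ (U : Filter α) F) < _ at hb
  rw [Filter.Germ.coe_lt] at ha hb
  have hroot : ∀ᶠ i in (U : Filter α), ∃ c, a i < c ∧ c < b i ∧
      eval c (P.map (Pi.evalRingHom _ i)) = 0 := by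
    filter_upwards [hab, ha, hb] with i h1 h2 h3 using hF _ _ _ h1 h2 h3
  obtain ⟨c, hc⟩ := hroot.choice
  refine ⟨(c : Filter.Germ (U : Filter α) F), ?_, ?_, ?_⟩
  · exact Filter.Germ.coe_lt.2 (hc.mono fun _ h => h.1)
  · exact Filter.Germ.coe_lt.2 (hc.mono fun _ h => h.2.1)
  · rw [key]
    exact Filter.Germ.coe_eq.2 (hc.mono fun _ h => h.2.2)

section Transfer

variable {L K M : Type*} [Field L] [LinearOrder L] [IsStrictOrderedRing L]
  [Field K] [LinearOrder K] [IsStrictOrderedRing K]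
  [Field M] [LinearOrder M] [IsStrictOrderedRing M]

theorem Polynomial.exists_forall_le_eval_map {i : L →+* K} (hi : StrictMono i) (p : L[X])
    (hp : 0 < p.leadingCoeff) :
    ∃ B ε : L, 0 < ε ∧ ∀ x : K, i B ≤ x → i ε ≤ (p.map i).eval x := by
  induction hn : p.natDegree generalizing p with
  | zero =>
    obtain ⟨a, rfl⟩ := natDegree_eq_zero.1 hn
    exact ⟨0, a, by simpa using hp, fun x _ => by simp⟩
  | succ n ih =>
    have hdeg : p.divX.natDegree = n := by rw [natDegree_divX_eq_natDegree_tsub_one, hn]; rfl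
    have hlead : p.divX.leadingCoeff = p.leadingCoeff := by
      rw [leadingCoeff, leadingCoeff, hdeg, hn, coeff_divX]
    obtain ⟨B, ε, hε, hB⟩ := ih p.divX (hlead ▸ hp) hdeg
    refine ⟨max (max B 0) ((1 - p.coeff 0) / ε), 1, one_pos, fun x hx => ?_⟩
    have h1 : i B ≤ x := (hi.monotone ((le_max_left _ _).trans (le_max_left _ _))).trans hx
    have h2 : 0 ≤ x := by
      simpa using (hi.monotone ((le_max_right B 0).trans (le_max_left _ _))).trans hx
    have h3 : i ((1 - p.coeff 0) / ε) ≤ x := (hi.monotone (le_max_right _ _)).trans hx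
    have hε' : 0 < i ε := by simpa using hi hε
    rw [map_div₀, div_le_iff₀ hε', map_sub, map_one] at h3
    have h4 := mul_le_mul_of_nonneg_right (hB x h1) h2
    rw [← divX_mul_X_add p]
    simp only [Polynomial.map_add, Polynomial.map_mul, map_X, map_C, eval_add, eval_mul, eval_X,
      eval_C, map_one]
    linarith

theorem Polynomial.exists_gt_of_root {i : L →+* K} (hi : StrictMono i) {p : L[X]} (hp : p ≠ 0)
    {x : K} (hx : (p.map i).eval x = 0) : ∃ B : L, x < i B := by
  wlog hpos : 0 < p.leadingCoeff generalizing p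
  · refine this (neg_ne_zero.2 hp) (by simp [hx]) ?_
    rw [leadingCoeff_neg, neg_pos]
    exact lt_of_le_of_ne (not_lt.1 hpos) (leadingCoeff_ne_zero.2 hp)
  obtain ⟨B, ε, hε, hB⟩ := p.exists_forall_le_eval_map hi hpos
  refine ⟨B, lt_of_not_ge fun h => ?_⟩
  have := hB x h
  rw [hx, ← map_zero i, hi.le_iff_le] at this
  exact absurd hε this.not_gt

theorem Polynomial.exists_lt_of_root {i : L →+* K} (hi : StrictMono i) {p : L[X]} (hp : p ≠ 0)
    {x : K} (hx : (p.map i).eval x = 0) : ∃ B : L, i B < x := by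
  obtain ⟨B, hB⟩ := exists_gt_of_root hi (p := p.comp (-X)) (x := -x)
    (by rwa [Ne, comp_neg_X_eq_zero_iff]) (by simpa [Polynomial.map_comp] using hx)
  exact ⟨-B, by rw [map_neg]; linarith⟩

omit [IsStrictOrderedRing L] [IsStrictOrderedRing K] in
theorem Polynomial.exists_gap {i : L →+* K} {h : L[X]} (hh : h ≠ 0) {x : K}
    (hx : x ∉ Set.range i) (hlo : ∃ B, i B < x) (hhi : ∃ B, x < i B) :
    ∃ c d : L, i c < x ∧ x < i d ∧ ∀ t, c < t → t < d → h.eval t ≠ 0 := by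
  classical
  obtain ⟨lo, hlo⟩ := hlo
  obtain ⟨hi', hhi⟩ := hhi
  obtain ⟨c, hc, hcmax⟩ := Finset.exists_max_image
    (insert lo (h.roots.toFinset.filter (fun t => i t < x))) id ⟨lo, by simp⟩
  obtain ⟨d, hd, hdmin⟩ := Finset.exists_min_image
    (insert hi' (h.roots.toFinset.filter (fun t => x < i t))) id ⟨hi', by simp⟩
  refine ⟨c, d, ?_, ?_, fun t hct htd h0 => ?_⟩
  · rcases Finset.mem_insert.1 hc with rfl | hc
    exacts [hlo, (Finset.mem_filter.1 hc).2]
  · rcases Finset.mem_insert.1 hd with rfl | hd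
    exacts [hhi, (Finset.mem_filter.1 hd).2]
  · rcases lt_trichotomy (i t) x with h1 | h1 | h1
    · exact (hcmax t (by simp [hh, h0, h1])).not_gt hct
    · exact hx ⟨t, h1⟩
    · exact (hdmin t (by simp [hh, h0, h1])).not_gt htd

omit [IsStrictOrderedRing L] [IsStrictOrderedRing K] in
theorem Polynomial.eval_map_ne_zero_of_gap {i : L →+* K} (hi : StrictMono i) {h : L[X]} {c d : L}
    (hgap : ∀ t, c < t → t < d → h.eval t ≠ 0)
    (hr : ∀ x, (h.map i).eval x = 0 → x ∈ Set.range i) (x : K) (hcx : i c < x) (hxd : x < i d) :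
    (h.map i).eval x ≠ 0 := by
  intro h0
  obtain ⟨t, rfl⟩ := hr x h0
  refine hgap t (hi.lt_iff_lt.1 hcx) (hi.lt_iff_lt.1 hxd) ?_
  rw [eval_map_apply] at h0
  simpa using h0

omit [IsStrictOrderedRing L] in
theorem Polynomial.eval_pos_iff_of_gap (hK : PolynomialIVT K) {i : L →+* K} (hi : StrictMono i)
    {g : L[X]} {c d m : L} {x : K} (hg : ∀ y, i c < y → y < i d → (g.map i).eval y ≠ 0)
    (hcx : i c < x) (hxd : x < i d) (hcm : c < m) (hmd : m < d) :
    0 < (g.map i).eval x ↔ 0 < g.eval m := by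
  have := hK.eval_mul_pos (g.map i) hg ⟨hcx, hxd⟩ ⟨hi hcm, hi hmd⟩
  rw [pos_iff_pos_of_mul_pos this, eval_map_apply, ← map_zero i, hi.lt_iff_lt]

omit [IsStrictOrderedRing L] in
theorem Polynomial.exists_root_transfer (hK : PolynomialIVT K) (hM : PolynomialIVT M)
    {i : L →+* K} (hi : StrictMono i) {j : L →+* M} (hj : StrictMono j) {p : L[X]} {c d : L}
    (hgap : ∀ x, i c < x → x < i d → (p.derivative.map i).eval x ≠ 0) {x : K}
    (hcx : i c < x) (hxd : x < i d) (hx : (p.map i).eval x = 0) :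
    ∃ y, j c < y ∧ y < j d ∧ (p.map j).eval y = 0 := by
  rw [← derivative_map] at hgap
  have h1 := hK.eval_mul_eval_neg (p.map i) hgap ⟨hcx, hxd⟩ hx
  rw [eval_map_apply, eval_map_apply, ← map_mul, ← map_zero i, hi.lt_iff_lt] at h1
  refine hM.exists_root_of_mul_neg (p.map j) (hj (hi.lt_iff_lt.1 (hcx.trans hxd))) ?_
  rwa [eval_map_apply, eval_map_apply, ← map_mul, ← map_zero j, hj.lt_iff_lt]

theorem Polynomial.exists_root_same_signs (hK : PolynomialIVT K) (hM : PolynomialIVT M)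
    {i : L →+* K} (hi : StrictMono i) {j : L →+* M} (hj : StrictMono j) {p : L[X]} (hp : p ≠ 0)
    (hroots : ∀ g : L[X], g ≠ 0 → g.natDegree < p.natDegree →
      (∀ x, (g.map i).eval x = 0 → x ∈ Set.range i) ∧
      (∀ y, (g.map j).eval y = 0 → y ∈ Set.range j))
    {x : K} (hx : (p.map i).eval x = 0) (hxi : x ∉ Set.range i) :
    ∃ y : M, (p.map j).eval y = 0 ∧ ∀ g : L[X], g.natDegree < p.natDegree →
      (0 < (g.map i).eval x ↔ 0 < (g.map j).eval y) := by
  have hdeg : p.natDegree ≠ 0 := by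
    intro h0
    obtain ⟨a, rfl⟩ := natDegree_eq_zero.1 h0
    simp at hx
    simp [hx] at hp
  have hder : p.derivative ≠ 0 := by
    intro h0
    exact hdeg (Polynomial.derivative_eq_zero.1 h0)
  have hderlt := natDegree_derivative_lt hdeg
  have hlo := exists_lt_of_root hi hp hx
  have hhi := exists_gt_of_root hi hp hx
  obtain ⟨c₀, d₀, hc₀, hd₀, hgap₀⟩ := exists_gap hder hxi hlo hhi
  have hgapK := eval_map_ne_zero_of_gap hi hgap₀ (hroots _ hder hderlt).1
  have hgapM := eval_map_ne_zero_of_gap hj hgap₀ (hroots _ hder hderlt).2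
  obtain ⟨y, hy1, hy2, hy⟩ := exists_root_transfer hK hM hi hj hgapK hc₀ hd₀ hx
  refine ⟨y, hy, fun g hg => ?_⟩
  by_cases hg0 : g = 0
  · simp [hg0]
  obtain ⟨c₁, d₁, hc₁, hd₁, hgap₁⟩ := exists_gap hg0 hxi hlo hhi
  have hgK := eval_map_ne_zero_of_gap hi hgap₁ (hroots _ hg0 hg).1
  have hgM := eval_map_ne_zero_of_gap hj hgap₁ (hroots _ hg0 hg).2
  have hcx : i (max c₀ c₁) < x := by rw [hi.monotone.map_max]; exact max_lt hc₀ hc₁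
  have hxd : x < i (min d₀ d₁) := by rw [hi.monotone.map_min]; exact lt_min hd₀ hd₁
  have hc0 : i c₀ ≤ i (max c₀ c₁) := hi.monotone (le_max_left _ _)
  have hc1 : i c₁ ≤ i (max c₀ c₁) := hi.monotone (le_max_right _ _)
  have hd0 : i (min d₀ d₁) ≤ i d₀ := hi.monotone (min_le_left _ _)
  have hd1 : i (min d₀ d₁) ≤ i d₁ := hi.monotone (min_le_right _ _)
  have hc0' : j c₀ ≤ j (max c₀ c₁) := hj.monotone (le_max_left _ _)
  have hc1' : j c₁ ≤ j (max c₀ c₁) := hj.monotone (le_max_right _ _)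
  have hd0' : j (min d₀ d₁) ≤ j d₀ := hj.monotone (min_le_left _ _)
  have hd1' : j (min d₀ d₁) ≤ j d₁ := hj.monotone (min_le_right _ _)
  obtain ⟨y', hy1', hy2', hy'⟩ := exists_root_transfer hK hM hi hj
    (fun z h1 h2 => hgapK z (hc0.trans_lt h1) (h2.trans_le hd0)) hcx hxd hx
  obtain rfl : y' = y := by
    rw [← derivative_map] at hgapM
    exact hM.eq_of_isRoot _ hgapM ⟨hc0'.trans_lt hy1', hy2'.trans_le hd0'⟩ ⟨hy1, hy2⟩ hy' hy
  obtain ⟨m, hm1, hm2⟩ := exists_between (hi.lt_iff_lt.1 (hcx.trans hxd))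
  rw [eval_pos_iff_of_gap hK hi (fun z h1 h2 => hgK z (hc1.trans_lt h1) (h2.trans_le hd1))
    hcx hxd hm1 hm2, eval_pos_iff_of_gap hM hj
    (fun z h1 h2 => hgM z (hc1'.trans_lt h1) (h2.trans_le hd1')) hy1' hy2' hm1 hm2]

end Transfer

theorem Polynomial.eval₂_inv_pos_iff {R F : Type*} [CommRing R] [Field F] [LinearOrder F]
    [IsStrictOrderedRing F] (i : R →+* F) {x : F} (hx : x ≠ 0) (g : R[X]) :
    0 < eval₂ i x⁻¹ g ↔ 0 < eval₂ i x (reflect (2 * g.natDegree) g) := by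
  let _ : Invertible x⁻¹ := ⟨x, mul_inv_cancel₀ hx, inv_mul_cancel₀ hx⟩
  have h1 : eval₂ i x (reflect (2 * g.natDegree) g) * x⁻¹ ^ (2 * g.natDegree) = eval₂ i x⁻¹ g :=
    eval₂_reflect_mul_pow i x⁻¹ (2 * g.natDegree) g (by lia)
  rw [← h1, mul_pos_iff_of_pos_right ((even_two_mul _).pow_pos (inv_ne_zero hx))]

section Amalgam

variable {K M : Type*} [Field K] [LinearOrder K] [IsStrictOrderedRing K]
  [Field M] [LinearOrder M] [IsStrictOrderedRing M]

/-- A subring of `K × M` in which both coordinates of every element have the same sign, that is,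
the graph of an order isomorphism between a subring of `K` and a subring of `M`. -/
def Subring.SameSigns (G : Subring (K × M)) : Prop := ∀ z ∈ G, 0 < z.1 ↔ 0 < z.2

namespace Subring.SameSigns

variable {G : Subring (K × M)}

theorem neg_iff (hG : G.SameSigns) {z : K × M} (hz : z ∈ G) : z.1 < 0 ↔ z.2 < 0 := by
  simpa using hG (-z) (neg_mem hz)

theorem eq_zero_iff (hG : G.SameSigns) {z : K × M} (hz : z ∈ G) : z.1 = 0 ↔ z.2 = 0 := by
  have h1 := hG z hz
  have h2 := hG.neg_iff hz
  constructor <;> intro h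
  · rw [h] at h1 h2
    exact le_antisymm (not_lt.1 fun h' => lt_irrefl _ (h1.2 h'))
      (not_lt.1 fun h' => lt_irrefl _ (h2.2 h'))
  · rw [h] at h1 h2
    exact le_antisymm (not_lt.1 fun h' => lt_irrefl _ (h1.1 h'))
      (not_lt.1 fun h' => lt_irrefl _ (h2.1 h'))

omit [IsStrictOrderedRing K] [IsStrictOrderedRing M] in
theorem exists_le_maximal (hG : G.SameSigns) :
    ∃ H : Subring (K × M), G ≤ H ∧ Maximal SameSigns H := by
  refine zorn_le_nonempty₀ {H : Subring (K × M) | H.SameSigns} (fun c hc hchain y hy => ?_) G hG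
  refine ⟨sSup c, fun z hz => ?_, fun _ => le_sSup⟩
  obtain ⟨H, hH, hzH⟩ := (Subring.mem_sSup_of_directedOn ⟨y, hy⟩ hchain.directedOn).1 hz
  exact hc hH z hzH

omit [IsStrictOrderedRing K] [IsStrictOrderedRing M] in
theorem mem_of_maximal (hG : Maximal SameSigns G) {x : K} {y : M}
    (h : ∀ g : G[X], 0 < eval₂ ((RingHom.fst K M).comp G.subtype) x g ↔
      0 < eval₂ ((RingHom.snd K M).comp G.subtype) y g) : (x, y) ∈ G := by
  have hle : G ≤ (eval₂RingHom G.subtype (x, y)).range := fun z hz => ⟨C ⟨z, hz⟩, by simp⟩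
  refine hG.2 (y := (eval₂RingHom G.subtype (x, y)).range) ?_ hle ⟨X, by simp⟩
  rintro _ ⟨g, rfl⟩
  have h1 := hom_eval₂ g G.subtype (RingHom.fst K M) (x, y)
  have h2 := hom_eval₂ g G.subtype (RingHom.snd K M) (x, y)
  have := h g
  simp only [RingHom.coe_fst, RingHom.coe_snd] at h1 h2
  rwa [← h1, ← h2] at this

theorem inv_mem_of_maximal (hG : Maximal SameSigns G) {z : K × M} (hz : z ∈ G) (h0 : z.1 ≠ 0) :
    (z.1⁻¹, z.2⁻¹) ∈ G := by
  have h0' : z.2 ≠ 0 := fun h => h0 ((hG.1.eq_zero_iff hz).2 h)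
  refine mem_of_maximal hG fun g => ?_
  rw [Polynomial.eval₂_inv_pos_iff _ h0, Polynomial.eval₂_inv_pos_iff _ h0']
  set r := reflect (2 * g.natDegree) g
  have h1 := eval₂_at_apply (p := r) ((RingHom.fst K M).comp G.subtype) ⟨z, hz⟩
  have h2 := eval₂_at_apply (p := r) ((RingHom.snd K M).comp G.subtype) ⟨z, hz⟩
  have h3 := hG.1 _ (r.eval (⟨z, hz⟩ : G)).2
  change 0 < ((RingHom.fst K M).comp G.subtype) (r.eval ⟨z, hz⟩) ↔
    0 < ((RingHom.snd K M).comp G.subtype) (r.eval ⟨z, hz⟩) at h3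
  rw [← h1, ← h2] at h3
  exact h3

end Subring.SameSigns

open Subring.SameSigns in
theorem exists_maximal_partial_embedding {D : Type*} [CommRing D] (u : D →+* K) (v : D →+* M)
    (huv : ∀ d, 0 < u d ↔ 0 < v d) :
    ∃ (L : Subfield K) (j : L →+* M), StrictMono j ∧ (∀ d, ∃ l : L, (l : K) = u d ∧ j l = v d) ∧
      ∀ x y, (∀ g : L[X], 0 < (g.map L.subtype).eval x ↔ 0 < (g.map j).eval y) →
        ∃ l : L, (l : K) = x ∧ j l = y := by
  obtain ⟨G, hle, hG⟩ := exists_le_maximal (G := (u.prod v).range) (by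
    rintro _ ⟨d, rfl⟩
    exact huv d)
  let L : Subfield K :=
    { G.map (RingHom.fst K M) with
      inv_mem' := by
        rintro _ ⟨z, hz, rfl⟩
        rcases eq_or_ne z.1 0 with h0 | h0
        · exact ⟨0, G.zero_mem, by simp [h0]⟩
        · exact ⟨_, inv_mem_of_maximal hG hz h0, rfl⟩ }
  have hmem : ∀ l : L, ∃ y, ((l : K), y) ∈ G := by
    rintro ⟨_, z, hz, rfl⟩
    exact ⟨z.2, hz⟩
  choose f hf using hmem
  have huniq : ∀ {x : K} {y y' : M}, (x, y) ∈ G → (x, y') ∈ G → y = y' := by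
    intro x y y' h h'
    have := (hG.1.eq_zero_iff (sub_mem h h')).1 (by simp)
    exact sub_eq_zero.1 (by simpa using this)
  let j : L →+* M :=
    { toFun := f
      map_one' := huniq (hf 1) G.one_mem
      map_zero' := huniq (hf 0) G.zero_mem
      map_mul' := fun a b => huniq (hf (a * b)) (G.mul_mem (hf a) (hf b))
      map_add' := fun a b => huniq (hf (a + b)) (G.add_mem (hf a) (hf b)) }
  have hj : ∀ l : L, ((l : K), j l) ∈ G := hf
  have hlift : ∀ {x : K} {y : M}, (x, y) ∈ G → ∃ l : L, (l : K) = x ∧ j l = y := by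
    intro x y h
    exact ⟨⟨x, (x, y), h, rfl⟩, rfl, huniq (hj _) h⟩
  refine ⟨L, j, fun a b hab => ?_, fun d => hlift (hle ⟨d, rfl⟩), fun x y h => hlift ?_⟩
  · have := (hG.1 _ (sub_mem (hj b) (hj a))).1 (by simpa using hab)
    simpa using this
  · refine mem_of_maximal hG fun g => ?_
    let e : G →+* L :=
      { toFun := fun z => ⟨z.1.1, z.1, z.2, rfl⟩
        map_one' := rfl
        map_zero' := rfl
        map_mul' := fun _ _ => rfl
        map_add' := fun _ _ => rfl }
    have h1 : (RingHom.fst K M).comp G.subtype = L.subtype.comp e := rfl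
    have h2 : (RingHom.snd K M).comp G.subtype = j.comp e := by
      ext z
      exact huniq z.2 (hj (e z))
    have := h (g.map e)
    rwa [Polynomial.map_map, Polynomial.map_map, ← h1, ← h2, eval_map, eval_map] at this

theorem exists_partial_embedding_closed (hK : PolynomialIVT K) (hM : PolynomialIVT M)
    {D : Type*} [CommRing D] (u : D →+* K) (v : D →+* M) (huv : ∀ d, 0 < u d ↔ 0 < v d) :
    ∃ (L : Subfield K) (j : L →+* M), StrictMono j ∧ (∀ d, ∃ l : L, (l : K) = u d ∧ j l = v d) ∧
      ∀ g : L[X], g ≠ 0 → ∀ x, (g.map L.subtype).eval x = 0 → x ∈ Set.range L.subtype := by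
  obtain ⟨L, j, hj, hD, hmax⟩ := exists_maximal_partial_embedding u v huv
  refine ⟨L, j, hj, hD, ?_⟩
  have hi : StrictMono L.subtype := fun _ _ h => h
  have extend : ∀ p : L[X], p ≠ 0 → ∀ x y, (p.map L.subtype).eval x = 0 → (p.map j).eval y = 0 →
      (∀ g : L[X], g.natDegree < p.natDegree →
        (0 < (g.map L.subtype).eval x ↔ 0 < (g.map j).eval y)) →
      ∃ l : L, (l : K) = x ∧ j l = y := by
    intro p hp x y hx hy h
    have hdeg : p.natDegree ≠ 0 := by
      intro h0
      obtain ⟨a, rfl⟩ := natDegree_eq_zero.1 h0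
      simp at hx
      simp [hx] at hp
    refine hmax x y fun g => ?_
    have := h (g % p) (natDegree_mod_lt g hdeg)
    rw [← EuclideanDomain.div_add_mod g p]
    simpa [hx, hy] using this
  have main : ∀ n, ∀ p : L[X], p ≠ 0 → p.natDegree = n →
      (∀ x, (p.map L.subtype).eval x = 0 → x ∈ Set.range L.subtype) ∧
      (∀ y, (p.map j).eval y = 0 → y ∈ Set.range j) := by
    intro n
    induction n using Nat.strong_induction_on with
    | _ n ih =>
      intro p hp hn
      have hroots : ∀ g : L[X], g ≠ 0 → g.natDegree < p.natDegree → _ :=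
        fun g hg0 hg => ih _ (hn ▸ hg) g hg0 rfl
      constructor
      · intro x hx
        by_contra hxi
        obtain ⟨y, hy, hs⟩ := exists_root_same_signs hK hM hi hj hp hroots hx hxi
        obtain ⟨l, hl, -⟩ := extend p hp x y hx hy hs
        exact hxi ⟨l, hl⟩
      · intro y hy
        by_contra hyj
        obtain ⟨x, hx, hs⟩ := exists_root_same_signs hM hK hj hi hp
          (fun g hg0 hg => (hroots g hg0 hg).symm) hy hyj
        obtain ⟨l, -, hl⟩ := extend p hp x y hx hy fun g hg => (hs g hg).symm
        exact hyj ⟨l, hl⟩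
  exact fun g hg => (main _ g hg rfl).1

theorem exists_same_signs_of_closed (hK : PolynomialIVT K) (L : Subfield K)
    (hL : ∀ g : L[X], g ≠ 0 → ∀ x, (g.map L.subtype).eval x = 0 → x ∈ Set.range L.subtype)
    (S : Finset L[X]) (x : K) :
    ∃ m : L, ∀ g ∈ S, 0 < (g.map L.subtype).eval x ↔ 0 < g.eval m := by
  classical
  have hi : StrictMono L.subtype := fun _ _ h => h
  by_cases hx : x ∈ Set.range L.subtype
  · obtain ⟨m, rfl⟩ := hx
    refine ⟨m, fun g _ => ?_⟩
    rw [eval_map_apply, ← map_zero L.subtype, hi.lt_iff_lt]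
  let T : Finset L := S.biUnion fun g => g.roots.toFinset
  obtain ⟨m, hlo, hhi⟩ := Order.exists_between_finsets (T.filter fun t : L => (t : K) < x)
    (T.filter fun t : L => x < (t : K)) (by
      intro a ha b hb
      exact hi.lt_iff_lt.1 ((Finset.mem_filter.1 ha).2.trans (Finset.mem_filter.1 hb).2))
  refine ⟨m, fun g hg => ?_⟩
  by_cases hg0 : g = 0
  · simp [hg0]
  have hT : ∀ t : L, g.eval t = 0 → t ∈ T := fun t ht => by
    simp only [T, Finset.mem_biUnion]
    exact ⟨g, hg, by simpa [hg0] using ht⟩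
  have hside : ∀ t ∈ T, ((t : K) < x ∧ t < m) ∨ (x < (t : K) ∧ m < t) := by
    intro t ht
    rcases lt_trichotomy (t : K) x with h | h | h
    · exact .inl ⟨h, hlo t (by simp [ht, h])⟩
    · exact absurd ⟨t, h⟩ hx
    · exact .inr ⟨h, hhi t (by simp [ht, h])⟩
  have hgm : g.eval m ≠ 0 := fun h => by
    rcases hside m (hT m h) with h | h <;> exact lt_irrefl _ h.2
  have hgx : (g.map L.subtype).eval x ≠ 0 := fun h => hx (hL g hg0 x h)
  have hgm' : (g.map L.subtype).eval (m : K) = (g.eval m : L) := 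
    eval_map_apply L.subtype m
  have hroot : ∀ c, (g.map L.subtype).eval c = 0 → ((c < x ∧ c < m) ∨ (x < c ∧ m < c)) := by
    intro c hc
    obtain ⟨t, rfl⟩ := hL g hg0 c hc
    rw [eval_map_apply] at hc
    exact hside t (hT t (by simpa using hc))
  have hpos : 0 < (g.map L.subtype).eval x * (g.map L.subtype).eval (m : K) := by
    by_contra hneg
    have hlt := lt_of_le_of_ne (not_lt.1 hneg)
      (mul_ne_zero hgx (by rw [hgm']; simpa using hgm))
    rcases lt_trichotomy x m with h | h | h
    · obtain ⟨c, h1, h2, h3⟩ := hK.exists_root_of_mul_neg _ h hlt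
      rcases hroot c h3 with h' | h'
      exacts [h'.1.not_gt h1, h'.2.not_gt h2]
    · exact hx ⟨m, h.symm⟩
    · rw [mul_comm] at hlt
      obtain ⟨c, h1, h2, h3⟩ := hK.exists_root_of_mul_neg _ h hlt
      rcases hroot c h3 with h' | h'
      exacts [h'.2.not_gt h1, h'.1.not_gt h2]
  rw [pos_iff_pos_of_mul_pos hpos, hgm']
  exact hi.lt_iff_lt (a := 0)

theorem exists_same_signs_of_polynomialIVT (hK : PolynomialIVT K) (hM : PolynomialIVT M)
    {D : Type*} [CommRing D] (u : D →+* K) (v : D →+* M) (huv : ∀ d, 0 < u d ↔ 0 < v d)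
    (S : Finset D[X]) (x : K) : ∃ y : M, ∀ g ∈ S, 0 < eval₂ u x g ↔ 0 < eval₂ v y g := by
  classical
  obtain ⟨L, j, hj, hD, hL⟩ := exists_partial_embedding_closed hK hM u v huv
  choose f hfu hfv using hD
  let φ : D →+* L :=
    { toFun := f
      map_one' := L.subtype.injective (by simp [hfu])
      map_zero' := L.subtype.injective (by simp [hfu])
      map_mul' := fun a b => L.subtype.injective (by simp [hfu])
      map_add' := fun a b => L.subtype.injective (by simp [hfu]) }
  have hu : u = L.subtype.comp φ := RingHom.ext fun d => (hfu d).symm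
  have hv : v = j.comp φ := RingHom.ext fun d => (hfv d).symm
  obtain ⟨m, hm⟩ := exists_same_signs_of_closed hK L hL (S.image (Polynomial.map φ)) x
  refine ⟨j m, fun g hg => ?_⟩
  have h1 : eval₂ u x g = ((g.map φ).map L.subtype).eval x := by
    rw [Polynomial.map_map, ← hu, eval_map]
  have h2 : eval₂ v (j m) g = j ((g.map φ).eval m) := by
    rw [← eval_map_apply, Polynomial.map_map, ← hv, eval_map]
  rw [h1, h2, hm _ (Finset.mem_image_of_mem _ hg), ← map_zero j, hj.lt_iff_lt]

end Amalgam

section RealPoints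

theorem MvPolynomial.eval₂Hom_cons {R F : Type*} [CommRing R] [CommRing F] (ρ : R →+* F) {n : ℕ}
    (x : F) (a : Fin n → F) (g : MvPolynomial (Fin (n + 1)) R) :
    MvPolynomial.eval₂Hom ρ (Fin.cons x a : Fin (n + 1) → F) g =
      Polynomial.eval₂ (MvPolynomial.eval₂Hom ρ a) x (MvPolynomial.finSuccEquiv R n g) := by
  suffices h : MvPolynomial.eval₂Hom ρ (Fin.cons x a : Fin (n + 1) → F) =
      (Polynomial.eval₂RingHom (MvPolynomial.eval₂Hom ρ a) x).comp
        (MvPolynomial.finSuccEquiv R n : MvPolynomial (Fin (n + 1)) R →+* _) from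
    congrArg (fun φ => φ g) h
  refine MvPolynomial.ringHom_ext (fun r => ?_) fun i => ?_
  · simp [MvPolynomial.finSuccEquiv_apply]
  · refine Fin.cases ?_ (fun i => ?_) i <;>
      simp [MvPolynomial.finSuccEquiv_X_zero, MvPolynomial.finSuccEquiv_X_succ]

theorem Ultrafilter.eventually_iff_of_iff_eventually {α : Type*} (U : Ultrafilter α) {p : Prop}
    {q : α → Prop} (h : p ↔ ∀ᶠ b in (U : Filter α), q b) : ∀ᶠ b in (U : Filter α), (p ↔ q b) := by
  by_cases hp : p
  · simpa [hp] using h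
  · simpa [hp, ← Ultrafilter.eventually_not] using h

theorem Ultrafilter.eventually_of_eventually_iff {α : Type*} (U : Ultrafilter α) {p : Prop}
    {q : α → Prop} (h : ∀ᶠ b in (U : Filter α), (p ↔ q b)) : p ↔ ∀ᶠ b in (U : Filter α), q b := by
  by_cases hp : p
  · simpa [hp] using h
  · simpa [hp, ← Ultrafilter.eventually_not] using h

variable {K : Type*} [Field K] [LinearOrder K] [IsStrictOrderedRing K]

theorem RingHom.pos_iff_of_real (ρ : ℝ →+* K) (r : ℝ) : 0 < ρ r ↔ 0 < r := by
  have h : ∀ s : ℝ, 0 < s → 0 < ρ s := fun s hs => by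
    have : ρ s = ρ √s ^ 2 := by rw [← map_pow, Real.sq_sqrt hs.le]
    rw [this]
    exact sq_pos_of_ne_zero ((map_ne_zero ρ).2 (Real.sqrt_pos.2 hs).ne')
  refine ⟨fun hr => ?_, h r⟩
  rcases lt_trichotomy 0 r with h1 | h1 | h1
  · exact h1
  · simp [← h1] at hr
  · have := h (-r) (by linarith)
    rw [map_neg] at this
    linarith

theorem exists_real_same_signs (hK : PolynomialIVT K) (ρ : ℝ →+* K) :
    ∀ (n : ℕ) (a : Fin n → K) (S : Finset (MvPolynomial (Fin n) ℝ)), ∃ b : Fin n → ℝ,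
      ∀ g ∈ S, 0 < MvPolynomial.eval₂Hom ρ a g ↔ 0 < MvPolynomial.eval b g := by
  classical
  intro n
  induction n with
  | zero =>
    intro a S
    refine ⟨Fin.elim0, fun g _ => ?_⟩
    obtain ⟨r, rfl⟩ := MvPolynomial.C_surjective (Fin 0) g
    simpa using ρ.pos_iff_of_real r
  | succ n ih =>
    intro a S
    let T : MvPolynomial (Fin n) ℝ → Set (Fin n → ℝ) := fun g =>
      {b | 0 < MvPolynomial.eval₂Hom ρ (Fin.tail a) g ↔ 0 < MvPolynomial.eval b g}
    obtain ⟨U, hU⟩ := Ultrafilter.exists_ultrafilter_of_finite_inter_nonempty (Set.range T) (by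
      intro A hA
      obtain ⟨B, -, rfl⟩ := Finset.subset_set_image_iff.1
        (hA.trans_eq (Set.image_univ (f := T)).symm)
      obtain ⟨b, hb⟩ := ih (Fin.tail a) B
      exact ⟨b, by simpa [T] using hb⟩)
    let w : MvPolynomial (Fin n) ℝ →+* ((Fin n → ℝ) → ℝ) :=
      RingHom.pi fun b => MvPolynomial.eval b
    let v := (Filter.Germ.coeRingHom (U : Filter (Fin n → ℝ))).comp w
    have hpos : ∀ f : (Fin n → ℝ) → ℝ,
        0 < Filter.Germ.coeRingHom (R := ℝ) (U : Filter (Fin n → ℝ)) f ↔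
          ∀ᶠ b in (U : Filter (Fin n → ℝ)), 0 < f b := fun f => Filter.Germ.coe_pos
    have huv : ∀ d, 0 < MvPolynomial.eval₂Hom ρ (Fin.tail a) d ↔ 0 < v d := fun d =>
      (U.eventually_of_eventually_iff (hU ⟨d, rfl⟩)).trans (hpos _).symm
    obtain ⟨y, hy⟩ := exists_same_signs_of_polynomialIVT hK (PolynomialIVT.real.germ U) _ v huv
      (S.image (MvPolynomial.finSuccEquiv ℝ n)) (a 0)
    induction y using Filter.Germ.inductionOn with | _ f
    have hev : ∀ g ∈ S, ∀ᶠ b in (U : Filter (Fin n → ℝ)),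
        (0 < MvPolynomial.eval₂Hom ρ a g ↔
          0 < MvPolynomial.eval (Fin.cons (f b) b : Fin (n + 1) → ℝ) g) := by
      intro g hg
      refine U.eventually_iff_of_iff_eventually ?_
      have h1 := hy _ (Finset.mem_image_of_mem _ hg)
      rw [← MvPolynomial.eval₂Hom_cons, Fin.cons_self_tail] at h1
      have h2 := Polynomial.hom_eval₂ (MvPolynomial.finSuccEquiv ℝ n g) w
        (Filter.Germ.coeRingHom (U : Filter (Fin n → ℝ))) f
      have h3 : ∀ b, Polynomial.eval₂ w f (MvPolynomial.finSuccEquiv ℝ n g) b =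
          MvPolynomial.eval (Fin.cons (f b) b : Fin (n + 1) → ℝ) g := fun b =>
        (Polynomial.hom_eval₂ (MvPolynomial.finSuccEquiv ℝ n g) w (Pi.evalRingHom _ b) f).trans
          (MvPolynomial.eval₂Hom_cons (RingHom.id ℝ) (f b) b g).symm
      rw [h1]
      refine (iff_of_eq (congrArg (0 < ·) h2.symm)).trans ((hpos _).trans ?_)
      simp only [h3]
    obtain ⟨b, hb⟩ := ((S.eventually_all (l := (U : Filter (Fin n → ℝ)))).2 hev).exists
    exact ⟨_, hb⟩

end RealPoints

theorem IsSumSq.map_ringHom {R S : Type*} [Semiring R] [Semiring S] (φ : R →+* S) {s : R}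
    (hs : IsSumSq s) : IsSumSq (φ s) := by
  induction hs with
  | zero => simp
  | sq_add a _ ih =>
    rw [map_add, map_mul]
    exact .sq_add _ ih

theorem IsSumSq.exists_map_eq {R S : Type*} [Semiring R] [Semiring S] {φ : R →+* S}
    (hφ : Function.Surjective φ) {s : S} (hs : IsSumSq s) : ∃ t, IsSumSq t ∧ φ t = s := by
  induction hs with
  | zero => exact ⟨0, .zero, map_zero φ⟩
  | sq_add a _ ih =>
    obtain ⟨t, ht, rfl⟩ := ih
    obtain ⟨b, rfl⟩ := hφ a
    exact ⟨b * b + t, .sq_add _ ht, by simp⟩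

theorem IsSumSq.exists_subfield_of_sSup {Ω : Type*} [Field Ω] {c : Set (Subfield Ω)}
    (hne : c.Nonempty) (hc : DirectedOn (· ≤ ·) c) {z : (sSup c : Subfield Ω)} (hz : IsSumSq z) :
    ∃ H ∈ c, ∃ w : H, IsSumSq w ∧ (w : Ω) = z := by
  induction hz with
  | zero =>
    obtain ⟨H, hH⟩ := hne
    exact ⟨H, hH, 0, .zero, rfl⟩
  | sq_add a _ ih =>
    obtain ⟨H, hH, w, hw, hwz⟩ := ih
    obtain ⟨H', hH', ha⟩ := (Subfield.mem_sSup_of_directedOn hne hc).1 a.2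
    obtain ⟨E, hE, h1, h2⟩ := hc H hH H' hH'
    refine ⟨E, hE, ⟨a, h2 ha⟩ * ⟨a, h2 ha⟩ + Subfield.inclusion h1 w,
      .sq_add _ (hw.map_ringHom _), ?_⟩
    simp only [Subfield.coe_add, Subfield.coe_mul, ← hwz]
    rfl

/-- A field in which `-1` is not a sum of squares, while it becomes one in every proper finite
extension generated by one element. -/
structure IsMaximalSemireal (K : Type*) [Field K] : Prop where
  not_isSumSq_neg_one : ¬IsSumSq (-1 : K)
  isSumSq_neg_one_adjoinRoot : ∀ (q : K[X]) [Fact (Irreducible q)], 1 < q.natDegree →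
    IsSumSq (-1 : AdjoinRoot q)

theorem exists_isMaximalSemireal {F : Type*} [Field F] (hF : ¬IsSumSq (-1 : F)) :
    ∃ K : Subfield (AlgebraicClosure F), IsMaximalSemireal K ∧ Nonempty (F →+* K) := by
  let K₀ := (algebraMap F (AlgebraicClosure F)).fieldRange
  have hK₀ : ¬IsSumSq (-1 : K₀) := fun h => hF (by
    obtain ⟨t, ht, h1⟩ := h.exists_map_eq
      (algebraMap F (AlgebraicClosure F)).rangeRestrictField_bijective.surjective
    have : t = -1 :=
      (algebraMap F (AlgebraicClosure F)).rangeRestrictField.injective (by simpa using h1)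
    rwa [← this])
  obtain ⟨K, hle, hK⟩ := zorn_le_nonempty₀
    {H : Subfield (AlgebraicClosure F) | ¬IsSumSq (-1 : H)} (fun c hc hchain y hy => by
      refine ⟨sSup c, fun h => ?_, fun _ => le_sSup⟩
      obtain ⟨H, hH, w, hw, h1⟩ := h.exists_subfield_of_sSup ⟨y, hy⟩ hchain.directedOn
      have : w = -1 := Subtype.ext (by simpa using h1)
      exact hc hH (this ▸ hw)) K₀ hK₀
  refine ⟨K, ⟨hK.1, fun q hq hdeg => ?_⟩,
    ⟨(Subfield.inclusion hle).comp (algebraMap F (AlgebraicClosure F)).rangeRestrictField⟩⟩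
  obtain ⟨θ, hθ⟩ := IsAlgClosed.exists_eval₂_eq_zero K.subtype q hq.out.degree_pos.ne'
  let φ := AdjoinRoot.lift K.subtype θ hθ
  have hKφ : K ≤ φ.fieldRange := fun x hx =>
    ⟨AdjoinRoot.of q ⟨x, hx⟩, by simp [φ]⟩
  have hθφ : θ ∈ φ.fieldRange := ⟨AdjoinRoot.root q, by simp [φ]⟩
  have hθK : θ ∉ K := fun h => by
    have h1 : q.IsRoot (⟨θ, h⟩ : K) := by
      have := eval₂_at_apply (p := q) K.subtype ⟨θ, h⟩
      exact K.subtype.injective (by rw [map_zero, ← this]; exact hθ)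
    exact hdeg.ne' (natDegree_eq_of_degree_eq_some (degree_eq_one_of_irreducible_of_root hq.out h1))
  by_contra hns
  refine hθK (hK.2 (y := φ.fieldRange) (fun h => hns ?_) hKφ hθφ)
  obtain ⟨t, ht, h1⟩ := h.exists_map_eq φ.rangeRestrictField_bijective.surjective
  have : t = -1 := φ.rangeRestrictField.injective (by simpa using h1)
  rwa [← this]

namespace IsMaximalSemireal

variable {K : Type*} [Field K]

/-- Sums of squares of polynomials of degree less than the degree of `q`. -/
noncomputable def smallSumSq (q : K[X]) : AddSubmonoid K[X] :=
  AddSubmonoid.closure {g | ∃ h : K[X], h.degree < q.degree ∧ g = h * h}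

theorem exists_smallSumSq_mk_eq (q : K[X]) (hq : q ≠ 0) {z : AdjoinRoot q} (hz : IsSumSq z) :
    ∃ σ ∈ smallSumSq q, AdjoinRoot.mk q σ = z := by
  induction hz with
  | zero => exact ⟨0, zero_mem _, map_zero _⟩
  | sq_add a _ ih =>
    obtain ⟨σ, hσ, rfl⟩ := ih
    obtain ⟨g, rfl⟩ := AdjoinRoot.mk_surjective a
    have hg : AdjoinRoot.mk q (g % q) = AdjoinRoot.mk q g :=
      AdjoinRoot.mk_eq_mk.2 ((EuclideanDomain.mod_eq_sub_mul_div g q).symm ▸ ⟨-(g / q), by ring⟩)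
    refine ⟨(g % q) * (g % q) + σ, add_mem (AddSubmonoid.subset_closure ⟨_, ?_, rfl⟩) hσ, ?_⟩
    · exact EuclideanDomain.mod_lt g hq
    · simp [hg]

theorem exists_dvd_one_add (hK : IsMaximalSemireal K) {q : K[X]} (hq : Irreducible q)
    (hdeg : 1 < q.natDegree) : ∃ σ ∈ smallSumSq q, q ∣ 1 + σ := by
  have : Fact (Irreducible q) := ⟨hq⟩
  obtain ⟨σ, hσ, h⟩ := exists_smallSumSq_mk_eq q hq.ne_zero (hK.isSumSq_neg_one_adjoinRoot q hdeg)
  exact ⟨σ, hσ, AdjoinRoot.mk_eq_zero.1 (by simp [h])⟩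

theorem isSumSq_neg_of_not_isSquare (hK : IsMaximalSemireal K) {x : K} (hx : ¬IsSquare x) :
    IsSumSq (-x) := by
  have hdeg : (X ^ 2 - C x).natDegree = 2 := natDegree_X_pow_sub_C
  have hirr : Irreducible (X ^ 2 - C x) := by
    refine (irreducible_iff_roots_eq_zero_of_degree_le_three (by lia) (by lia)).2 ?_
    refine Multiset.eq_zero_of_forall_notMem fun r hr => hx ?_
    have := (mem_roots'.1 hr).2
    simp only [IsRoot.def, eval_sub, eval_pow, eval_X, eval_C, sub_eq_zero] at this
    exact ⟨r, by rw [← this, sq]⟩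
  obtain ⟨σ, hσ, hdvd⟩ := hK.exists_dvd_one_add hirr (by lia)
  have hform : ∃ a b c : K, IsSumSq a ∧ IsSumSq b ∧ σ = C a + C b * X ^ 2 + C c * X := by
    clear hdvd
    induction hσ using AddSubmonoid.closure_induction with
    | mem g hg =>
      obtain ⟨h, hh, rfl⟩ := hg
      have h2 : h.degree ≤ 1 := by
        have h3 : (X ^ 2 - C x).degree = 2 := degree_X_pow_sub_C (by norm_num) x
        rw [h3] at hh
        exact Order.lt_succ_iff.1 hh
      rw [eq_X_add_C_of_degree_le_one h2]
      refine ⟨h.coeff 0 * h.coeff 0, h.coeff 1 * h.coeff 1, 2 * h.coeff 0 * h.coeff 1,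
        .mul_self _, .mul_self _, ?_⟩
      simp only [map_mul, map_ofNat]
      ring
    | zero => exact ⟨0, 0, 0, .zero, .zero, by simp⟩
    | add g h _ _ ihg ihh =>
      obtain ⟨a, b, c, ha, hb, rfl⟩ := ihg
      obtain ⟨a', b', c', ha', hb', rfl⟩ := ihh
      refine ⟨a + a', b + b', c + c', ha.add ha', hb.add hb', ?_⟩
      simp only [map_add]
      ring
  obtain ⟨a, b, c, ha, hb, rfl⟩ := hform
  have hzero : C c * X + C (1 + a + b * x) = 0 := by
    refine eq_zero_of_dvd_of_natDegree_lt (p := X ^ 2 - C x) ?_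
      (lt_of_le_of_lt natDegree_linear_le (by lia))
    have h1 : C c * X + C (1 + a + b * x) =
        (1 + (C a + C b * X ^ 2 + C c * X)) - (X ^ 2 - C x) * C b := by
      simp only [map_add, map_mul, map_one]
      ring
    rw [h1]
    exact dvd_sub hdvd (dvd_mul_right _ _)
  have h0 : 1 + a + b * x = 0 := by simpa using congrArg (eval 0) hzero
  have hb0 : b ≠ 0 := fun h => hK.not_isSumSq_neg_one (by
    have : -1 = a := by linear_combination -h0 + x * h
    rwa [this])
  have h1 : -x = (1 + a) * b * (b⁻¹ * b⁻¹) := by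
    field_simp
    linear_combination -h0
  rw [h1]
  exact ((IsSumSq.one.add ha).mul hb).mul (.mul_self _)

theorem eq_zero_of_isSumSq_of_isSumSq_neg (hK : IsMaximalSemireal K) {x : K} (hx : IsSumSq x)
    (hnx : IsSumSq (-x)) : x = 0 := by
  by_contra h0
  refine hK.not_isSumSq_neg_one ?_
  have h1 : -1 = x * -x * (x⁻¹ * x⁻¹) := by field_simp
  rw [h1]
  exact (hx.mul hnx).mul (.mul_self _)

theorem isSquare_of_isSumSq (hK : IsMaximalSemireal K) {x : K} (hx : IsSumSq x) : IsSquare x := by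
  by_contra h
  rw [hK.eq_zero_of_isSumSq_of_isSumSq_neg hx (hK.isSumSq_neg_of_not_isSquare h)] at h
  exact h (.zero)

/-- The cone of sums of squares. -/
def cone (hK : IsMaximalSemireal K) : RingCone K where
  __ := Subsemiring.sumSq K
  eq_zero_of_mem_of_neg_mem' := by
    intro a h1 h2
    exact hK.eq_zero_of_isSumSq_of_isSumSq_neg (by simpa using h1) (by simpa using h2)

theorem exists_linearOrder (hK : IsMaximalSemireal K) :
    ∃ _ : LinearOrder K, IsStrictOrderedRing K := by
  classical
  have : HasMemOrNegMem hK.cone := ⟨fun x => by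
    have hmem : ∀ y : K, y ∈ hK.cone ↔ IsSumSq y := fun y => by
      change y ∈ Subsemiring.sumSq K ↔ _
      simp
    rw [hmem, hmem]
    by_cases hx : IsSquare x
    · exact .inl hx.isSumSq
    · exact .inr (hK.isSumSq_neg_of_not_isSquare hx)⟩
  let i : LinearOrder K := .mkOfAddGroupCone hK.cone
  have h := IsOrderedRing.mkOfCone hK.cone
  exact ⟨i, h.toIsStrictOrderedRing⟩

variable [LinearOrder K] [IsStrictOrderedRing K]

theorem eval_nonneg_of_mem_smallSumSq {q σ : K[X]} (hσ : σ ∈ smallSumSq q) (x : K) :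
    0 ≤ σ.eval x := by
  induction hσ using AddSubmonoid.closure_induction with
  | mem g hg =>
    obtain ⟨h, -, rfl⟩ := hg
    simpa using mul_self_nonneg (h.eval x)
  | zero => simp
  | add g h _ _ ihg ihh => simpa using add_nonneg ihg ihh

omit [LinearOrder K] [IsStrictOrderedRing K] in
theorem natDegree_one_add_lt_of_mem_smallSumSq {q σ : K[X]} (hq : 0 < q.natDegree)
    (hσ : σ ∈ smallSumSq q) : (1 + σ).natDegree < 2 * q.natDegree := by
  have : σ.natDegree < 2 * q.natDegree := by
    induction hσ using AddSubmonoid.closure_induction with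
    | mem g hg =>
      obtain ⟨h, hh, rfl⟩ := hg
      have := natDegree_mul_le (p := h) (q := h)
      have h2 : h.natDegree < q.natDegree := by
        rcases eq_or_ne h 0 with rfl | h0
        · simpa
        · exact natDegree_lt_natDegree h0 hh
      lia
    | zero => simpa
    | add g h _ _ ihg ihh => exact (natDegree_add_le _ _).trans_lt (max_lt ihg ihh)
  exact (natDegree_add_le _ _).trans_lt (max_lt (by simpa) this)

theorem exists_root_of_mul_neg (hK : IsMaximalSemireal K) {a b : K} (hab : a < b) :
    ∀ (d : ℕ) (p : K[X]), p.natDegree = d → p.eval a * p.eval b < 0 →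
      ∃ c, a < c ∧ c < b ∧ p.eval c = 0 := by
  intro d
  induction d using Nat.strong_induction_on with
  | _ d ih =>
    intro p hd hp
    have hp0 : p ≠ 0 := fun h => by simp [h] at hp
    have hd0 : p.natDegree ≠ 0 := fun h => by
      obtain ⟨r, rfl⟩ := natDegree_eq_zero.1 h
      simp only [eval_C] at hp
      exact (mul_self_nonneg r).not_gt hp
    by_cases hirr : Irreducible p
    · by_cases hd1 : p.natDegree = 1
      · obtain ⟨r, s, hr, rfl⟩ : ∃ r s : K, r ≠ 0 ∧ p = C r * X + C s :=
          ⟨p.coeff 1, p.coeff 0, by rw [← hd1]; exact leadingCoeff_ne_zero.2 hp0,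
            eq_X_add_C_of_natDegree_le_one hd1.le⟩
        have h1 : ∀ x, eval x (C r * X + C s) = r * (x - -s / r) := fun x => by
          simp
          field_simp
          ring
        rw [h1, h1] at hp
        have h2 : (a - -s / r) * (b - -s / r) < 0 := by
          have h3 : 0 < r * r := mul_self_pos.2 hr
          by_contra h
          nlinarith [mul_nonneg h3.le (not_lt.1 h)]
        refine ⟨-s / r, ?_, ?_, by rw [h1]; simp⟩
        · by_contra h
          nlinarith [mul_nonneg (sub_nonneg.2 (not_lt.1 h)) (sub_nonneg.2 ((not_lt.1 h).trans hab.le))]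
        · by_contra h
          nlinarith [mul_nonneg (sub_nonneg.2 (not_lt.1 h)) (sub_nonneg.2 (hab.le.trans (not_lt.1 h)))]
      · obtain ⟨σ, hσ, g, hg⟩ := hK.exists_dvd_one_add hirr (by lia)
        have hpos : ∀ x, 0 < p.eval x * g.eval x := fun x => by
          rw [← eval_mul, ← hg, eval_add, eval_one]
          linarith [eval_nonneg_of_mem_smallSumSq hσ x]
        have hg0 : g ≠ 0 := fun h => by simpa [h] using hpos a
        have hdeg := natDegree_one_add_lt_of_mem_smallSumSq (by lia) hσ
        rw [hg, natDegree_mul hp0 hg0] at hdeg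
        obtain ⟨c, -, -, hc⟩ := ih g.natDegree (by lia) g rfl (by
          by_contra h
          nlinarith [mul_pos (hpos a) (hpos b), mul_nonneg (neg_nonneg.2 hp.le) (not_lt.1 h)])
        exact absurd (hpos c) (by simp [hc])
    · obtain ⟨r, s, hr, hs, rfl⟩ : ∃ r s : K[X], ¬IsUnit r ∧ ¬IsUnit s ∧ p = r * s := by
        rw [irreducible_iff] at hirr
        push Not at hirr
        obtain ⟨r, s, h1, h2, h3⟩ := hirr fun h => hd0 (natDegree_eq_zero_of_isUnit h)
        exact ⟨r, s, h2, h3, h1⟩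
      have hr0 := left_ne_zero_of_mul hp0
      have hs0 := right_ne_zero_of_mul hp0
      rw [natDegree_mul hr0 hs0] at hd
      have hr1 : r.natDegree ≠ 0 := fun h => hr (isUnit_iff_degree_eq_zero.2 (by
        rw [degree_eq_natDegree hr0, h]; rfl))
      have hs1 : s.natDegree ≠ 0 := fun h => hs (isUnit_iff_degree_eq_zero.2 (by
        rw [degree_eq_natDegree hs0, h]; rfl))
      by_cases h : r.eval a * r.eval b < 0
      · obtain ⟨c, h1, h2, h3⟩ := ih r.natDegree (by lia) r rfl h
        exact ⟨c, h1, h2, by simp [h3]⟩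
      · obtain ⟨c, h1, h2, h3⟩ := ih s.natDegree (by lia) s rfl (by
          by_contra h'
          have := mul_nonneg (not_lt.1 h) (not_lt.1 h')
          simp only [eval_mul] at hp
          nlinarith)
        exact ⟨c, h1, h2, by simp [h3]⟩

theorem polynomialIVT (hK : IsMaximalSemireal K) : PolynomialIVT K := fun p _ _ hab ha hb =>
  hK.exists_root_of_mul_neg hab _ p rfl (mul_neg_of_neg_of_pos ha hb)

end IsMaximalSemireal

section RealPrime

variable {A : Type*} [CommRing A]

/-- The elements `f ^ (2 * m) + σ` with `σ` a sum of squares. -/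
def evenPowersAddSumSq (f : A) : Submonoid A where
  carrier := {t | ∃ (m : ℕ) (σ : A), IsSumSq σ ∧ t = f ^ (2 * m) + σ}
  one_mem' := ⟨0, 0, .zero, by simp⟩
  mul_mem' := by
    rintro _ _ ⟨m, σ, hσ, rfl⟩ ⟨k, τ, hτ, rfl⟩
    have hsq : ∀ l : ℕ, IsSumSq (f ^ (2 * l)) := fun l => by
      rw [two_mul, pow_add]
      exact .mul_self _
    refine ⟨m + k, f ^ (2 * m) * τ + σ * f ^ (2 * k) + σ * τ,
      (((hsq m).mul hτ).add (hσ.mul (hsq k))).add (hσ.mul hτ), by ring⟩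

theorem exists_isPrime_forall_sq_add_notMem {J : Ideal A} {f : A}
    (hJ : ∀ (m : ℕ) (σ : A), IsSumSq σ → f ^ (2 * m) + σ ∉ J) :
    ∃ p : Ideal A, p.IsPrime ∧ J ≤ p ∧ f ∉ p ∧ ∀ d ∉ p, ∀ s, IsSumSq s → d * d + s ∉ p := by
  have hdisj : Disjoint (J : Set A) (evenPowersAddSumSq f) := Set.disjoint_right.2 fun t ht => by
    obtain ⟨m, σ, hσ, rfl⟩ := ht
    exact hJ m σ hσ
  obtain ⟨p, hJp, hp⟩ := zorn_le_nonempty₀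
    {p : Ideal A | Disjoint (p : Set A) (evenPowersAddSumSq f)} (fun c hc hchain y hy => by
      refine ⟨sSup c, Set.disjoint_left.2 fun x hx => ?_, fun _ => le_sSup⟩
      obtain ⟨q, hq, hxq⟩ := (Submodule.mem_sSup_of_directed ⟨y, hy⟩ hchain.directedOn).1 hx
      exact Set.disjoint_left.1 (hc hq) hxq) J hdisj
  have hprime := Ideal.isPrime_of_maximally_disjoint p _ hp.1 fun _ => hp.not_prop_of_gt
  refine ⟨p, hprime, hJp, fun hf => ?_, fun d hd s hs hmem => ?_⟩
  · exact Set.disjoint_left.1 hp.1 (p.mul_mem_right f hf) ⟨1, 0, .zero, by ring⟩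
  · have hlt : p < p ⊔ Ideal.span {d} :=
      left_lt_sup.2 fun h => hd (h (Ideal.mem_span_singleton_self d))
    obtain ⟨t, ht, hts⟩ := Set.not_disjoint_iff.1 (hp.not_prop_of_gt hlt)
    obtain ⟨a, ha, b, hb, rfl⟩ := Submodule.mem_sup.1 ht
    obtain ⟨h, rfl⟩ := Ideal.mem_span_singleton.1 hb
    refine Set.disjoint_left.1 hp.1
      (show (a + d * h) * (a + d * h) + s * (h * h) ∈ (p : Set A) from ?_) ?_
    · have : (a + d * h) * (a + d * h) + s * (h * h) =
          (a + 2 * d * h) * a + h * h * (d * d + s) := by ring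
      rw [SetLike.mem_coe, this]
      exact add_mem (p.mul_mem_left _ ha) (p.mul_mem_left _ hmem)
    · obtain ⟨m, σ, hσ, h1⟩ := (evenPowersAddSumSq f).mul_mem hts hts
      exact ⟨m, σ + s * (h * h), hσ.add (hs.mul (.mul_self h)), by rw [h1]; ring⟩

theorem IsSumSq.exists_mul_eq_algebraMap {B : Type*} [CommRing B] [IsDomain B]
    {z : FractionRing B} (hz : IsSumSq z) : ∃ d s : B, d ≠ 0 ∧ IsSumSq s ∧
      algebraMap B (FractionRing B) (d * d) * z = algebraMap B (FractionRing B) s := by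
  induction hz with
  | zero => exact ⟨1, 0, one_ne_zero, .zero, by simp⟩
  | sq_add x _ ih =>
    obtain ⟨d, s, hd, hs, h⟩ := ih
    obtain ⟨a, b, hb, rfl⟩ := IsFractionRing.div_surjective (A := B) x
    have hb0 : b ≠ 0 := nonZeroDivisors.ne_zero hb
    have hb1 : algebraMap B (FractionRing B) b ≠ 0 := by simpa using hb0
    refine ⟨d * b, (d * a) * (d * a) + s * (b * b), mul_ne_zero hd hb0,
      .sq_add _ (hs.mul (.mul_self b)), ?_⟩
    simp only [map_add, map_mul] at h ⊢
    rw [← h]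
    field_simp

theorem exists_ringHom_isMaximalSemireal.{u} {A : Type u} [CommRing A] {J : Ideal A} {f : A}
    (hJ : ∀ (m : ℕ) (σ : A), IsSumSq σ → f ^ (2 * m) + σ ∉ J) :
    ∃ (K : Type u) (_ : Field K) (φ : A →+* K), IsMaximalSemireal K ∧ (∀ g ∈ J, φ g = 0) ∧
      φ f ≠ 0 := by
  obtain ⟨p, hp, hJp, hfp, hreal⟩ := exists_isPrime_forall_sq_add_notMem hJ
  have hF : ¬IsSumSq (-1 : FractionRing (A ⧸ p)) := fun h => by
    obtain ⟨d, s, hd, hs, h1⟩ := h.exists_mul_eq_algebraMap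
    obtain ⟨t, ht, rfl⟩ := hs.exists_map_eq Ideal.Quotient.mk_surjective
    obtain ⟨e, rfl⟩ := Ideal.Quotient.mk_surjective d
    rw [mul_neg_one, ← map_neg] at h1
    have h2 := IsFractionRing.injective (A ⧸ p) (FractionRing (A ⧸ p)) h1
    refine hreal e (fun he => hd (Ideal.Quotient.eq_zero_iff_mem.2 he)) t ht ?_
    rw [← Ideal.Quotient.eq_zero_iff_mem, map_add, map_mul, ← h2, add_neg_cancel]
  obtain ⟨K, hK, ⟨ψ⟩⟩ := exists_isMaximalSemireal hF
  refine ⟨K, inferInstance,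
    (ψ.comp (algebraMap (A ⧸ p) (FractionRing (A ⧸ p)))).comp (Ideal.Quotient.mk p), hK,
    fun g hg => ?_, fun h => hfp ?_⟩
  · simp [Ideal.Quotient.eq_zero_iff_mem.2 (hJp hg)]
  · simpa [Ideal.Quotient.eq_zero_iff_mem] using h

end RealPrime

/-- A form of the real Nullstellensatz. -/
theorem MvPolynomial.exists_real_zero_of_forall_sq_add_notMem {n : ℕ}
    {J : Ideal (MvPolynomial (Fin n) ℝ)} {f : MvPolynomial (Fin n) ℝ}
    (hJ : ∀ (m : ℕ) (σ : MvPolynomial (Fin n) ℝ), IsSumSq σ → f ^ (2 * m) + σ ∉ J) :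
    ∃ b : Fin n → ℝ, (∀ g ∈ J, eval b g = 0) ∧ eval b f ≠ 0 := by
  classical
  obtain ⟨K, _, φ, hK, hφ, hf⟩ := exists_ringHom_isMaximalSemireal hJ
  obtain ⟨_, _⟩ := hK.exists_linearOrder
  obtain ⟨T, hT⟩ := (isNoetherianRing_iff_ideal_fg _).1 inferInstance J
  obtain ⟨b, hb⟩ := exists_real_same_signs hK.polynomialIVT (φ.comp C) n (fun i => φ (X i))
    (insert f T ∪ (insert f T).image Neg.neg)
  have h1 : eval₂Hom (φ.comp C) (fun i => φ (X i)) = φ :=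
    ringHom_ext (fun r => by simp) fun i => by simp
  rw [h1] at hb
  have h2 : ∀ g ∈ insert f T, φ g = 0 ↔ eval b g = 0 := by
    intro g hg
    have hpos := hb g (Finset.mem_union_left _ hg)
    have hneg := hb (-g) (Finset.mem_union_right _ (Finset.mem_image_of_mem _ hg))
    rw [map_neg, map_neg, neg_pos, neg_pos] at hneg
    rw [← not_iff_not, ← Ne, ← Ne, ne_iff_lt_or_gt, ne_iff_lt_or_gt]
    exact or_congr hneg hpos
  refine ⟨b, ?_, fun h => hf ((h2 f (by simp)).2 h)⟩
  have hle : J ≤ RingHom.ker (eval b) := hT ▸ Ideal.span_le.2 fun g hg =>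
    (h2 g (Finset.mem_insert_of_mem hg)).1 (hφ g (hT ▸ Ideal.subset_span hg))
  exact fun g hg => hle hg

end RealAlgebra

theorem IsSumSq.exists_fin_sum {R : Type*} [Semiring R] {s : R} (hs : IsSumSq s) :
    ∃ (k : ℕ) (q : Fin k → R), s = ∑ i, q i * q i := by
  induction hs with
  | zero => exact ⟨0, Fin.elim0, by simp⟩
  | sq_add a _ ih =>
    obtain ⟨k, q, rfl⟩ := ih
    exact ⟨k + 1, Fin.cons a q, by simp [Fin.sum_univ_succ]⟩

section Complexification

variable {n : ℕ}

theorem starC_map_ofReal (u : MvPolynomial (Fin n) ℝ) :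
    starC (MvPolynomial.map Complex.ofRealHom u) = MvPolynomial.map Complex.ofRealHom u := by
  have h : (starRingEnd ℂ).comp Complex.ofRealHom = Complex.ofRealHom :=
    RingHom.ext fun r => by simp
  rw [starC, MvPolynomial.map_map, h]

theorem exists_eq_map_ofReal_add (P : MvPolynomial (Fin n) ℂ) :
    ∃ u v : MvPolynomial (Fin n) ℝ, P = MvPolynomial.map Complex.ofRealHom u +
      MvPolynomial.C Complex.I * MvPolynomial.map Complex.ofRealHom v := by
  induction P using MvPolynomial.induction_on with
  | C a =>
    refine ⟨MvPolynomial.C a.re, MvPolynomial.C a.im, ?_⟩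
    rw [MvPolynomial.map_C, MvPolynomial.map_C, ← MvPolynomial.C_mul, ← MvPolynomial.C_add]
    congr 1
    simp [mul_comm Complex.I, Complex.re_add_im]
  | add p q hp hq =>
    obtain ⟨u, v, rfl⟩ := hp
    obtain ⟨u', v', rfl⟩ := hq
    exact ⟨u + u', v + v', by simp only [map_add]; ring⟩
  | mul_X p i hp =>
    obtain ⟨u, v, rfl⟩ := hp
    exact ⟨u * MvPolynomial.X i, v * MvPolynomial.X i, by
      simp only [map_mul, MvPolynomial.map_X]; ring⟩

theorem starC_map_ofReal_add (u v : MvPolynomial (Fin n) ℝ) :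
    starC (MvPolynomial.map Complex.ofRealHom u +
      MvPolynomial.C Complex.I * MvPolynomial.map Complex.ofRealHom v) =
    MvPolynomial.map Complex.ofRealHom u -
      MvPolynomial.C Complex.I * MvPolynomial.map Complex.ofRealHom v := by
  have hu := starC_map_ofReal u
  have hv := starC_map_ofReal v
  simp only [starC] at hu hv ⊢
  rw [map_add, map_mul, hu, hv, MvPolynomial.map_C, Complex.conj_I, map_neg]
  ring

theorem starC_mul_self_eq (u v : MvPolynomial (Fin n) ℝ) :
    starC (MvPolynomial.map Complex.ofRealHom u +
      MvPolynomial.C Complex.I * MvPolynomial.map Complex.ofRealHom v) *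
      (MvPolynomial.map Complex.ofRealHom u +
        MvPolynomial.C Complex.I * MvPolynomial.map Complex.ofRealHom v) =
    MvPolynomial.map Complex.ofRealHom (u ^ 2 + v ^ 2) := by
  have h : (MvPolynomial.C Complex.I : MvPolynomial (Fin n) ℂ) ^ 2 = -1 := by
    rw [← map_pow, Complex.I_sq, map_neg, map_one]
  rw [starC_map_ofReal_add]
  simp only [map_add, map_pow]
  linear_combination -(MvPolynomial.map Complex.ofRealHom v) ^ 2 * h

theorem evalC_map_ofReal (u : MvPolynomial (Fin n) ℝ) (x : Fin n → ℝ) :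
    evalC (MvPolynomial.map Complex.ofRealHom u) x = (MvPolynomial.eval x u : ℝ) := by
  rw [evalC, MvPolynomial.aeval_def, MvPolynomial.eval₂_map]
  exact (MvPolynomial.eval₂_comp_left Complex.ofRealHom (RingHom.id ℝ) x u).symm

theorem evalC_starC (P : MvPolynomial (Fin n) ℂ) (x : Fin n → ℝ) :
    evalC (starC P) x = starRingEnd ℂ (evalC P x) := by
  induction P using MvPolynomial.induction_on with
  | C a => simp [evalC, starC]
  | add p q hp hq =>
    simp only [evalC, starC, map_add] at hp hq ⊢
    rw [hp, hq]
  | mul_X p i hp =>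
    simp only [evalC, starC, map_mul] at hp ⊢
    rw [hp]
    simp

theorem evalC_starC_mul_self (P : MvPolynomial (Fin n) ℂ) (x : Fin n → ℝ) :
    evalC (starC P * P) x = (Complex.normSq (evalC P x) : ℂ) := by
  rw [Complex.normSq_eq_conj_mul_self, ← evalC_starC]
  simp [evalC]

theorem map_ofReal_mem_of_add_mem {I : Ideal (MvPolynomial (Fin n) ℂ)}
    (hstar : ∀ P ∈ I, starC P ∈ I) {u v : MvPolynomial (Fin n) ℝ}
    (h : MvPolynomial.map Complex.ofRealHom u +
      MvPolynomial.C Complex.I * MvPolynomial.map Complex.ofRealHom v ∈ I) :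
    MvPolynomial.map Complex.ofRealHom u ∈ I ∧ MvPolynomial.map Complex.ofRealHom v ∈ I := by
  have h2 := hstar _ h
  rw [starC_map_ofReal_add] at h2
  have hhalf : (MvPolynomial.C (1 / 2 : ℂ) : MvPolynomial (Fin n) ℂ) * 2 = 1 := by
    rw [← map_ofNat MvPolynomial.C 2, ← map_mul]
    simp
  have hI : (MvPolynomial.C Complex.I : MvPolynomial (Fin n) ℂ) ^ 2 = -1 := by
    rw [← map_pow, Complex.I_sq, map_neg, map_one]
  constructor
  · convert I.mul_mem_left (MvPolynomial.C (1 / 2 : ℂ)) (add_mem h h2) using 1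
    linear_combination -(MvPolynomial.map Complex.ofRealHom u) * hhalf
  · convert I.mul_mem_left (-MvPolynomial.C Complex.I * MvPolynomial.C (1 / 2 : ℂ))
      (sub_mem h h2) using 1
    linear_combination (MvPolynomial.C (1 / 2 : ℂ) * 2 * MvPolynomial.map Complex.ofRealHom v) * hI
      - (MvPolynomial.map Complex.ofRealHom v) * hhalf

end Complexification

theorem stmt_6 (n : ℕ) (hn : 0 < n) (I : Ideal (MvPolynomial (Fin n) ℂ))
    (hstar : ∀ P ∈ I, starC P ∈ I) (P : MvPolynomial (Fin n) ℂ) :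
    P ∈ vanishingIdealC (zeroSetC I) ↔
      ∃ (m s : ℕ) (Q : Fin s → MvPolynomial (Fin n) ℂ),
        (starC P * P) ^ (2 * m) + ∑ i, starC (Q i) * Q i ∈ I := by
  constructor
  · intro hP
    obtain ⟨u, v, huv⟩ := exists_eq_map_ofReal_add P
    have hf : starC P * P = MvPolynomial.map Complex.ofRealHom (u ^ 2 + v ^ 2) := by
      rw [huv, starC_mul_self_eq]
    by_cases hJ : ∀ (m : ℕ) (σ : MvPolynomial (Fin n) ℝ), IsSumSq σ →
        (u ^ 2 + v ^ 2) ^ (2 * m) + σ ∉ I.comap (MvPolynomial.map Complex.ofRealHom)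
    · obtain ⟨b, hb, hfb⟩ := MvPolynomial.exists_real_zero_of_forall_sq_add_notMem hJ
      have hbI : b ∈ zeroSetC I := by
        intro Q hQ
        obtain ⟨r, t, rfl⟩ := exists_eq_map_ofReal_add Q
        obtain ⟨hr, ht⟩ := map_ofReal_mem_of_add_mem hstar hQ
        have h1 := evalC_map_ofReal r b
        have h2 := evalC_map_ofReal t b
        rw [hb r hr] at h1
        rw [hb t ht] at h2
        simp only [evalC, map_add, map_mul] at h1 h2 ⊢
        simp [h1, h2]
      have h0 : evalC P b = 0 := hP b hbI
      have h1 := evalC_starC_mul_self P b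
      rw [hf, evalC_map_ofReal, h0, map_zero, Complex.ofReal_inj] at h1
      exact absurd h1 hfb
    · push Not at hJ
      obtain ⟨m, σ, hσ, hmem⟩ := hJ
      obtain ⟨s, q, rfl⟩ := hσ.exists_fin_sum
      refine ⟨m, s, fun i => MvPolynomial.map Complex.ofRealHom (q i), ?_⟩
      simp only [Ideal.mem_comap, map_add, map_pow, map_sum, map_mul] at hmem
      simpa only [hf, starC_map_ofReal, map_add, map_pow] using hmem
  · rintro ⟨m, s, Q, hQ⟩ x hx
    have h := hx _ hQ
    have h1 : evalC ((starC P * P) ^ (2 * m) + ∑ i, starC (Q i) * Q i) x =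
        ((Complex.normSq (evalC P x) ^ (2 * m) + ∑ i, Complex.normSq (evalC (Q i) x) : ℝ) : ℂ) := by
      have h2 : evalC ((starC P * P) ^ (2 * m) + ∑ i, starC (Q i) * Q i) x =
          evalC (starC P * P) x ^ (2 * m) + ∑ i, evalC (starC (Q i) * Q i) x := by
        simp only [evalC, map_add, map_pow, map_sum]
      rw [h2]
      simp only [evalC_starC_mul_self]
      push_cast
      rfl
    rw [h1, Complex.ofReal_eq_zero] at h
    have h3 : 0 ≤ ∑ i, Complex.normSq (evalC (Q i) x) :=
      Finset.sum_nonneg fun i _ => Complex.normSq_nonneg _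
    have h4 : 0 ≤ Complex.normSq (evalC P x) ^ (2 * m) := pow_nonneg (Complex.normSq_nonneg _) _
    have h5 : Complex.normSq (evalC P x) ^ (2 * m) = 0 := by linarith
    exact Complex.normSq_eq_zero.1 (eq_zero_of_pow_eq_zero h5)
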